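/- Let f_i, f_j, f_k : D → R be models with correct sets A_i, A_j, A_k, and let M be a natural number such that f_i and f_k agree on at most M incorrect responses, i.e. |{d ∈ D : f_i(d) = f_k(d) ∧ f_k(d) ≠ g(d)}| ≤ M. If |A_k| + M + |D| < |A_i| + |A_j|, then judge f_i votes f_k worse than f_j: |Agr(f_i, f_k)| < |Agr(f_i, f_j)|. -/

import Mathlib

/-- The set of prompts on which model `f` answers correctly w.r.t. ground truth `g`. -/
def correctSet {D R : Type*} [Fintype D] [DecidableEq R] (g f : D → R) : Finset D :=
  Finset.univ.filter fun d => f d = g d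

/-- The agreement set of two models `f`, `f'`. -/
def agr {D R : Type*} [Fintype D] [DecidableEq R] (f f' : D → R) : Finset D :=
  Finset.univ.filter fun d => f d = f' d

theorem card_agr_le_card_correctSet_add {D R : Type*} [Fintype D] [DecidableEq R]
    (g f f' : D → R) :
    (agr f f').card ≤ (correctSet g f').card +
      (Finset.univ.filter fun d => f d = f' d ∧ f' d ≠ g d).card := by
  classical
  refine (Finset.card_le_card fun d hd => ?_).trans (Finset.card_union_le _ _)
  simp only [agr, correctSet, Finset.mem_union, Finset.mem_filter, Finset.mem_univ,
    true_and] at hd ⊢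
  tauto

theorem card_correctSet_add_card_correctSet_le {D R : Type*} [Fintype D] [DecidableEq R]
    (g f f' : D → R) :
    (correctSet g f).card + (correctSet g f').card ≤ Fintype.card D + (agr f f').card := by
  classical
  rw [← Finset.card_union_add_card_inter]
  refine add_le_add (Finset.card_le_univ _) (Finset.card_le_card fun d hd => ?_)
  simp only [agr, correctSet, Finset.mem_inter, Finset.mem_filter, Finset.mem_univ,
    true_and] at hd ⊢
  exact hd.1.trans hd.2.symm

/-- If `f_i` and `f_k` agree on at most `M` incorrect responses and
`|A_k| + M + |D| < |A_i| + |A_j|`, then judge `f_i` votes `f_k` worse than `f_j`. -/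
theorem judge_i_votes_k_worse
    {D R : Type*} [Fintype D] [Nonempty D] [DecidableEq R]
    (g f_i f_j f_k : D → R) (M : ℕ)
    (hM : (Finset.univ.filter fun d => f_i d = f_k d ∧ f_k d ≠ g d).card ≤ M)
    (h : (correctSet g f_k).card + M + Fintype.card D <
      (correctSet g f_i).card + (correctSet g f_j).card) :
    (agr f_i f_k).card < (agr f_i f_j).card := by
  have hik := card_agr_le_card_correctSet_add g f_i f_k
  have hij := card_correctSet_add_card_correctSet_le g f_i f_j
  omega
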